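/- For every complete multipartite graph K_{r_1,…,r_k} with k ≥ 3 parts, every part of size at least 2 (r_k ≥ 2), and r_j = 3 for some j ∈ {1,…,k}, the game chromatic number satisfies χ_g(K_{r_1,…,r_k}) ≥ min{2k − 2, Σ_{i=1}^{k} ⌈r_i/2⌉}. -/

import Mathlib

/-- A color `c` is legal for vertex `v` in partial coloring `f` if no neighbor of `v`
is already colored with `c`. -/
def legalColor {V C : Type} (G : SimpleGraph V) (f : V → Option C) (v : V) (c : C) : Prop :=
  ∀ w, G.Adj v w → f w ≠ some c

/-- A move in the coloring game: choose an uncolored vertex and color it with a legal color. -/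
def gameMove {V C : Type} [DecidableEq V] (G : SimpleGraph V) (f f' : V → Option C) : Prop :=
  ∃ v c, f v = none ∧ legalColor G f v c ∧ f' = Function.update f v (some c)

/-- Every vertex is colored. -/
def isFull {V C : Type} (f : V → Option C) : Prop := ∀ v, (f v).isSome

/-- Some uncolored vertex has no legal color (then Bob wins). -/
def isStuck {V C : Type} (G : SimpleGraph V) (f : V → Option C) : Prop :=
  ∃ v, f v = none ∧ ∀ c, ¬ legalColor G f v c

/-- It is Alice's turn when an even number of vertices are colored
(Alice moves first, and each move colors exactly one vertex). -/
def aliceTurn {V C : Type} [Fintype V] (f : V → Option C) : Prop :=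
  Even (Finset.univ.filter (fun v => (f v).isSome = true)).card

/-- Alice has a winning strategy from position `f` when `n` vertices remain uncolored:
Alice wins exactly the plays in which the entire graph gets colored; as soon as some
uncolored vertex has no legal color, Bob wins. -/
def aliceWinsFrom {V C : Type} [Fintype V] [DecidableEq V] (G : SimpleGraph V) :
    ℕ → (V → Option C) → Prop
  | 0, f => isFull f
  | n + 1, f => isFull f ∨ (¬ isStuck G f ∧
      ((aliceTurn f ∧ ∃ f', gameMove G f f' ∧ aliceWinsFrom G n f') ∨
       (¬ aliceTurn f ∧ ∀ f', gameMove G f f' → aliceWinsFrom G n f')))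

/-- Alice has a winning strategy in the graph coloring game on `G` with `m` colors. -/
def aliceWins {V : Type} [Fintype V] [DecidableEq V] (G : SimpleGraph V) (m : ℕ) : Prop :=
  aliceWinsFrom (C := Fin m) G (Fintype.card V) (fun _ => none)

/-- The game chromatic number: the least number of colors for which Alice has
a winning strategy. -/
noncomputable def gameChromaticNumber {V : Type} [Fintype V] [DecidableEq V]
    (G : SimpleGraph V) : ℕ :=
  sInf {m | aliceWins G m}

/-- The complete multipartite graph `K_{r 0, …, r (k-1)}`. -/
def K (k : ℕ) (r : Fin k → ℕ) : SimpleGraph (Σ i : Fin k, Fin (r i)) :=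
  SimpleGraph.completeMultipartiteGraph (fun i => Fin (r i))

/-- Coloring one uncolored vertex increases the number of colored vertices by one. -/
theorem card_colored_update {V C : Type} [Fintype V] [DecidableEq V] (f : V → Option C)
    {v : V} (hv : f v = none) (c : C) :
    (Finset.univ.filter (fun w => (Function.update f v (some c) w).isSome = true)).card =
      (Finset.univ.filter (fun w => (f w).isSome = true)).card + 1 := by
  have h : Finset.univ.filter (fun w => (Function.update f v (some c) w).isSome = true) =
      insert v (Finset.univ.filter (fun w => (f w).isSome = true)) := by
    ext w
    by_cases hw : w = v
    · subst hw; simp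
    · simp [hw]
  rw [h, Finset.card_insert_of_notMem (by simp [hv])]

theorem aliceTurn_update {V C : Type} [Fintype V] [DecidableEq V] (f : V → Option C)
    {v : V} (hv : f v = none) (c : C) :
    aliceTurn (Function.update f v (some c)) ↔ ¬ aliceTurn f := by
  unfold aliceTurn
  rw [card_colored_update f hv c, Nat.even_add_one]

/-- With at least as many colors as vertices, Alice wins from every position. -/
theorem aliceWinsFrom_of_card_le {V C : Type} [Fintype V] [DecidableEq V] [Fintype C]
    (G : SimpleGraph V) (hC : Fintype.card V ≤ Fintype.card C) (n : ℕ) (f : V → Option C)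
    (hn : Fintype.card V ≤ (Finset.univ.filter (fun v => (f v).isSome = true)).card + n) :
    aliceWinsFrom G n f := by
  classical
  have key : ∀ g : V → Option C, ∀ v, g v = none → ∃ c, legalColor G g v c := by
    intro g v hv
    by_contra! hcon
    have hsurj : ∀ c : C, ∃ w, g w = some c := by
      intro c
      have := hcon c
      unfold legalColor at this
      push Not at this
      obtain ⟨w, -, hw⟩ := this
      exact ⟨w, hw⟩
    choose φ hφ using hsurj
    have hinj : Function.Injective φ := by
      intro a b hab
      have := hφ a
      rw [hab, hφ b] at this
      exact (Option.some.inj this).symm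
    have hlt := Fintype.card_lt_of_injective_of_notMem φ hinj (b := v) (by
      rintro ⟨c, rfl⟩
      simp [hφ] at hv)
    omega
  induction n generalizing f with
  | zero =>
    intro v
    have h : Finset.univ.filter (fun v => (f v).isSome = true) = Finset.univ :=
      Finset.eq_univ_of_card _ (le_antisymm (Finset.card_le_univ _) (by simpa using hn))
    have hv := Finset.mem_univ v
    rw [← h] at hv
    simpa using hv
  | succ n ih =>
    by_cases hfull : isFull f
    · exact Or.inl hfull
    refine Or.inr ⟨?_, ?_⟩
    · rintro ⟨v, hv, hc⟩
      obtain ⟨c, h⟩ := key f v hv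
      exact hc c h
    have step : ∀ f', gameMove G f f' → aliceWinsFrom G n f' := by
      rintro f' ⟨v, c, hv, -, rfl⟩
      apply ih
      rw [card_colored_update f hv c]
      omega
    by_cases ht : aliceTurn f
    · refine Or.inl ⟨ht, ?_⟩
      unfold isFull at hfull
      push Not at hfull
      obtain ⟨v, hv⟩ := hfull
      have hv : f v = none := by simpa using hv
      obtain ⟨c, h⟩ := key f v hv
      exact ⟨_, ⟨v, c, hv, h, rfl⟩, step _ ⟨v, c, hv, h, rfl⟩⟩
    · exact Or.inr ⟨ht, step⟩

theorem aliceWins_card {V : Type} [Fintype V] [DecidableEq V] (G : SimpleGraph V) :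
    aliceWins G (Fintype.card V) :=
  aliceWinsFrom_of_card_le G (by simp) _ _ (by omega)

/-- Alice has no winning strategy if Bob can maintain an invariant: `A` at Alice's turns and `B`
at Bob's turns. -/
theorem not_aliceWinsFrom_of_invariant {V C : Type} [Fintype V] [DecidableEq V]
    (G : SimpleGraph V) (A B : (V → Option C) → Prop)
    (hAfull : ∀ f, A f → ¬ isFull f) (hBfull : ∀ f, B f → ¬ isFull f)
    (hA : ∀ f f', A f → ¬ isStuck G f → gameMove G f f' → B f')
    (hB : ∀ f, B f → ¬ isStuck G f → ∃ f', gameMove G f f' ∧ A f')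
    (n : ℕ) (f : V → Option C) (h1 : aliceTurn f → A f) (h2 : ¬ aliceTurn f → B f) :
    ¬ aliceWinsFrom G n f := by
  have hfull : ∀ f, (aliceTurn f → A f) → (¬ aliceTurn f → B f) → ¬ isFull f := by
    intro f h1 h2
    by_cases ht : aliceTurn f
    · exact hAfull f (h1 ht)
    · exact hBfull f (h2 ht)
  induction n generalizing f with
  | zero => exact hfull f h1 h2
  | succ n ih =>
    rintro (h | ⟨hs, ⟨ht, f', hm, hw⟩ | ⟨ht, hw⟩⟩)
    · exact hfull f h1 h2 h
    · have hBf := hA f f' (h1 ht) hs hm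
      obtain ⟨v, c, hv, -, rfl⟩ := hm
      exact ih _ (fun h => absurd ht ((aliceTurn_update f hv c).1 h)) (fun _ => hBf) hw
    · obtain ⟨f', hm, hAf⟩ := hB f (h2 ht) hs
      have hw' := hw f' hm
      obtain ⟨v, c, hv, -, rfl⟩ := hm
      exact ih _ (fun _ => hAf) (fun h => absurd ((aliceTurn_update f hv c).2 ht) h) hw'

section Multipartite

variable {k m : ℕ} {r : Fin k → ℕ}

/-- The parts containing a colored vertex. -/
def touched (f : (Σ i : Fin k, Fin (r i)) → Option (Fin m)) : Finset (Fin k) :=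
  Finset.univ.filter (fun i => ∃ x, (f ⟨i, x⟩).isSome = true)

/-- The colors used by a partial coloring. -/
def usedColors (f : (Σ i : Fin k, Fin (r i)) → Option (Fin m)) : Finset (Fin m) :=
  Finset.univ.filter (fun c => ∃ v, f v = some c)

/-- The uncolored vertices in parts containing a colored vertex. -/
def freeTouched (f : (Σ i : Fin k, Fin (r i)) → Option (Fin m)) :
    Finset (Σ i : Fin k, Fin (r i)) :=
  Finset.univ.filter (fun v => f v = none ∧ v.1 ∈ touched f)

theorem mem_touched {f : (Σ i : Fin k, Fin (r i)) → Option (Fin m)} {i : Fin k} :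
    i ∈ touched f ↔ ∃ x, (f ⟨i, x⟩).isSome = true := by
  simp [touched]

theorem mem_usedColors {f : (Σ i : Fin k, Fin (r i)) → Option (Fin m)} {c : Fin m} :
    c ∈ usedColors f ↔ ∃ v, f v = some c := by
  simp [usedColors]

theorem touched_update (f : (Σ i : Fin k, Fin (r i)) → Option (Fin m))
    (v : Σ i : Fin k, Fin (r i)) (c : Fin m) :
    touched (Function.update f v (some c)) = insert v.1 (touched f) := by
  ext i
  rw [Finset.mem_insert, mem_touched, mem_touched]
  constructor
  · rintro ⟨x, hx⟩
    by_cases h : (⟨i, x⟩ : Σ i : Fin k, Fin (r i)) = v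
    · exact Or.inl (congrArg Sigma.fst h)
    · exact Or.inr ⟨x, by rwa [Function.update_of_ne h] at hx⟩
  · rintro (rfl | ⟨x, hx⟩)
    · exact ⟨v.2, by simp⟩
    · refine ⟨x, ?_⟩
      by_cases h : (⟨i, x⟩ : Σ i : Fin k, Fin (r i)) = v
      · simp [h]
      · rwa [Function.update_of_ne h]

theorem usedColors_update (f : (Σ i : Fin k, Fin (r i)) → Option (Fin m))
    {v : Σ i : Fin k, Fin (r i)} (hv : f v = none) (c : Fin m) :
    usedColors (Function.update f v (some c)) = insert c (usedColors f) := by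
  ext d
  rw [Finset.mem_insert, mem_usedColors, mem_usedColors]
  constructor
  · rintro ⟨w, hw⟩
    by_cases h : w = v
    · subst h
      simp at hw
      exact Or.inl hw.symm
    · exact Or.inr ⟨w, by rwa [Function.update_of_ne h] at hw⟩
  · rintro (rfl | ⟨w, hw⟩)
    · exact ⟨v, by simp⟩
    · refine ⟨w, ?_⟩
      rwa [Function.update_of_ne]
      rintro rfl
      simp [hv] at hw

theorem card_colored_add_card_freeTouched (f : (Σ i : Fin k, Fin (r i)) → Option (Fin m)) :
    (Finset.univ.filter (fun v => (f v).isSome = true)).card + (freeTouched f).card =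
      ∑ i ∈ touched f, r i := by
  have h : (touched f).sigma (fun i => (Finset.univ : Finset (Fin (r i)))) =
      Finset.univ.filter (fun v => (f v).isSome = true) ∪ freeTouched f := by
    ext ⟨i, x⟩
    simp only [Finset.mem_sigma, Finset.mem_univ, and_true, Finset.mem_union, Finset.mem_filter,
      true_and, freeTouched]
    constructor
    · intro hi
      cases hf : f ⟨i, x⟩ <;> simp [hi]
    · rintro (h | h)
      · exact mem_touched.2 ⟨x, h⟩
      · exact h.2
  rw [← Finset.card_union_of_disjoint, ← h, Finset.card_sigma]
  · simp
  · rw [Finset.disjoint_left]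
    intro v hv hv'
    simp only [Finset.mem_filter, freeTouched] at hv hv'
    simp [hv'.2.1] at hv

theorem legalColor_of_notMem_usedColors {f : (Σ i : Fin k, Fin (r i)) → Option (Fin m)}
    {c : Fin m} (hc : c ∉ usedColors f) (v : Σ i : Fin k, Fin (r i)) :
    legalColor (K k r) f v c :=
  fun w _ hw => hc (mem_usedColors.2 ⟨w, hw⟩)

theorem eq_none_of_notMem_touched {f : (Σ i : Fin k, Fin (r i)) → Option (Fin m)}
    {v : Σ i : Fin k, Fin (r i)} (hv : v.1 ∉ touched f) : f v = none := by
  by_contra h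
  exact hv (mem_touched.2 ⟨v.2, Option.isSome_iff_ne_none.2 h⟩)

theorem notMem_usedColors_of_legalColor {f : (Σ i : Fin k, Fin (r i)) → Option (Fin m)}
    {v : Σ i : Fin k, Fin (r i)} {c : Fin m} (hv : v.1 ∉ touched f)
    (hc : legalColor (K k r) f v c) : c ∉ usedColors f := by
  intro h
  obtain ⟨w, hw⟩ := mem_usedColors.1 h
  refine hc w ?_ hw
  intro (heq : v.1 = w.1)
  have hn : f w = none := eq_none_of_notMem_touched (heq ▸ hv)
  simp [hn] at hw

/-- If some part is untouched and the position is not stuck, there is an unused color. -/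
theorem exists_notMem_usedColors_of_not_isStuck {f : (Σ i : Fin k, Fin (r i)) → Option (Fin m)}
    {v : Σ i : Fin k, Fin (r i)} (hv : v.1 ∉ touched f) (hs : ¬ isStuck (K k r) f) :
    ∃ c, c ∉ usedColors f := by
  by_contra! h
  exact hs ⟨v, eq_none_of_notMem_touched hv, fun c hc =>
    notMem_usedColors_of_legalColor hv hc (h c)⟩

/-- The number of untouched parts. -/
def numUntouched (f : (Σ i : Fin k, Fin (r i)) → Option (Fin m)) : ℕ := (touched f)ᶜ.card

/-- The number of unused colors. -/
def numUnused (f : (Σ i : Fin k, Fin (r i)) → Option (Fin m)) : ℕ := (usedColors f)ᶜ.card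

/-- The sum of the half-sizes, rounded up, of the untouched parts. -/
def halfSum (f : (Σ i : Fin k, Fin (r i)) → Option (Fin m)) : ℕ :=
  ∑ i ∈ (touched f)ᶜ, (r i + 1) / 2

theorem numUnused_update_of_notMem (f : (Σ i : Fin k, Fin (r i)) → Option (Fin m))
    {v : Σ i : Fin k, Fin (r i)} (hv : f v = none) {c : Fin m} (hc : c ∉ usedColors f) :
    numUnused (Function.update f v (some c)) + 1 = numUnused f := by
  unfold numUnused
  rw [usedColors_update f hv, Finset.compl_insert,
    Finset.card_erase_add_one (Finset.mem_compl.2 hc)]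

theorem numUnused_update_le (f : (Σ i : Fin k, Fin (r i)) → Option (Fin m))
    {v : Σ i : Fin k, Fin (r i)} (hv : f v = none) (c : Fin m) :
    numUnused (Function.update f v (some c)) ≤ numUnused f := by
  unfold numUnused
  rw [usedColors_update f hv, Finset.compl_insert]
  exact Finset.card_erase_le

/-- The effect of coloring a vertex in a touched part. -/
theorem update_of_mem_touched (f : (Σ i : Fin k, Fin (r i)) → Option (Fin m))
    {v : Σ i : Fin k, Fin (r i)} (hv : f v = none) (ht : v.1 ∈ touched f) (c : Fin m) :
    numUntouched (Function.update f v (some c)) = numUntouched f ∧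
    halfSum (Function.update f v (some c)) = halfSum f ∧
    (freeTouched (Function.update f v (some c))).card + 1 = (freeTouched f).card := by
  have hT : touched (Function.update f v (some c)) = touched f := by
    rw [touched_update, Finset.insert_eq_of_mem ht]
  refine ⟨by rw [numUntouched, hT, numUntouched], by rw [halfSum, hT, halfSum], ?_⟩
  have h1 := card_colored_add_card_freeTouched f
  have h2 := card_colored_add_card_freeTouched (Function.update f v (some c))
  rw [hT, card_colored_update f hv] at h2
  omega

/-- The effect of coloring a vertex in an untouched part. -/
theorem update_of_notMem_touched (f : (Σ i : Fin k, Fin (r i)) → Option (Fin m))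
    {v : Σ i : Fin k, Fin (r i)} (ht : v.1 ∉ touched f) (c : Fin m) :
    numUntouched (Function.update f v (some c)) + 1 = numUntouched f ∧
    halfSum (Function.update f v (some c)) + (r v.1 + 1) / 2 = halfSum f ∧
    (freeTouched (Function.update f v (some c))).card + 1 = (freeTouched f).card + r v.1 := by
  have hT := touched_update f v c
  have hmem := Finset.mem_compl.2 ht
  refine ⟨?_, ?_, ?_⟩
  · rw [numUntouched, hT, Finset.compl_insert, Finset.card_erase_add_one hmem, numUntouched]
  · rw [halfSum, hT, Finset.compl_insert, Finset.sum_erase_add _ _ hmem, halfSum]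
  · have h1 := card_colored_add_card_freeTouched f
    have h2 := card_colored_add_card_freeTouched (Function.update f v (some c))
    rw [hT, card_colored_update f (eq_none_of_notMem_touched ht), Finset.sum_insert ht] at h2
    omega

/-- Bob's invariant at Alice's turns: either there are fewer unused colors than untouched parts,
or he can still use up the colors fast enough. -/
def bobInvariant (f : (Σ i : Fin k, Fin (r i)) → Option (Fin m)) : Prop :=
  numUnused f < numUntouched f ∨
    (numUnused f + 1 ≤ (freeTouched f).card / 2 + halfSum f ∧
      numUnused f + 2 ≤ 2 * numUntouched f ∧
      (2 ≤ (freeTouched f).card ∨ numUnused f + 3 ≤ 2 * numUntouched f))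

/-- Bob's invariant at his own turns. -/
def bobCanMove (f : (Σ i : Fin k, Fin (r i)) → Option (Fin m)) : Prop :=
  numUnused f < numUntouched f ∨
    (0 < numUntouched f ∧
      (¬ isStuck (K k r) f → ∃ f', gameMove (K k r) f f' ∧ bobInvariant f'))

theorem exists_notMem_touched (hr : ∀ j, 0 < r j)
    {f : (Σ i : Fin k, Fin (r i)) → Option (Fin m)} (h : 0 < numUntouched f) :
    ∃ v : Σ i : Fin k, Fin (r i), v.1 ∉ touched f := by
  obtain ⟨i, hi⟩ := Finset.card_pos.1 h
  exact ⟨⟨i, ⟨0, hr i⟩⟩, Finset.mem_compl.1 hi⟩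

theorem not_isFull_of_numUntouched_pos (hr : ∀ j, 0 < r j)
    {f : (Σ i : Fin k, Fin (r i)) → Option (Fin m)} (h : 0 < numUntouched f) : ¬ isFull f := by
  intro hf
  obtain ⟨v, hv⟩ := exists_notMem_touched hr h
  have := hf v
  simp [eq_none_of_notMem_touched hv] at this

theorem numUnused_lt_of_gameMove {f f' : (Σ i : Fin k, Fin (r i)) → Option (Fin m)}
    (h : numUnused f < numUntouched f) (hm : gameMove (K k r) f f') :
    numUnused f' < numUntouched f' := by
  obtain ⟨v, c, hv, hc, rfl⟩ := hm
  by_cases ht : v.1 ∈ touched f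
  · have h1 := (update_of_mem_touched f hv ht c).1
    have h2 := numUnused_update_le f hv c
    omega
  · have h1 := (update_of_notMem_touched f ht c).1
    have h2 := numUnused_update_of_notMem f hv (notMem_usedColors_of_legalColor ht hc)
    omega

/-- Bob can spend an unused color on an uncolored vertex of a touched part. -/
theorem exists_gameMove_freeTouched (hr : ∀ j, 0 < r j)
    {f : (Σ i : Fin k, Fin (r i)) → Option (Fin m)} (hu : 0 < numUntouched f)
    (hw : 0 < (freeTouched f).card) (hs : ¬ isStuck (K k r) f) :
    ∃ f', gameMove (K k r) f f' ∧ numUnused f' + 1 = numUnused f ∧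
      numUntouched f' = numUntouched f ∧ halfSum f' = halfSum f ∧
      (freeTouched f').card + 1 = (freeTouched f).card := by
  obtain ⟨v, hv⟩ := exists_notMem_touched hr hu
  obtain ⟨c, hc⟩ := exists_notMem_usedColors_of_not_isStuck hv hs
  obtain ⟨w, hw⟩ := Finset.card_pos.1 hw
  simp only [freeTouched, Finset.mem_filter, Finset.mem_univ, true_and] at hw
  exact ⟨_, ⟨w, c, hw.1, legalColor_of_notMem_usedColors hc w, rfl⟩,
    numUnused_update_of_notMem f hw.1 hc, update_of_mem_touched f hw.1 hw.2 c⟩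

/-- Bob can spend an unused color on any untouched part. -/
theorem exists_gameMove_untouched (hr : ∀ j, 0 < r j)
    {f : (Σ i : Fin k, Fin (r i)) → Option (Fin m)} {i : Fin k} (hi : i ∉ touched f)
    (hs : ¬ isStuck (K k r) f) :
    ∃ f', gameMove (K k r) f f' ∧ numUnused f' + 1 = numUnused f ∧
      numUntouched f' + 1 = numUntouched f ∧ halfSum f' + (r i + 1) / 2 = halfSum f ∧
      (freeTouched f').card + 1 = (freeTouched f).card + r i := by
  have hv : (⟨i, ⟨0, hr i⟩⟩ : Σ i : Fin k, Fin (r i)).1 ∉ touched f := hi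
  obtain ⟨c, hc⟩ := exists_notMem_usedColors_of_not_isStuck hv hs
  have hn := eq_none_of_notMem_touched hv
  exact ⟨_, ⟨_, c, hn, legalColor_of_notMem_usedColors hc _, rfl⟩,
    numUnused_update_of_notMem f hn hc, update_of_notMem_touched f hv c⟩

theorem bobCanMove_of_gameMove (h2 : ∀ j, 2 ≤ r j)
    {f f' : (Σ i : Fin k, Fin (r i)) → Option (Fin m)} (h : bobInvariant f)
    (hm : gameMove (K k r) f f') : bobCanMove f' := by
  have hr : ∀ j, 0 < r j := fun j => lt_of_lt_of_le two_pos (h2 j)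
  rcases h with h | ⟨hsum, hu, hw⟩
  · exact Or.inl (numUnused_lt_of_gameMove h hm)
  obtain ⟨v, c, hv, hc, hf'⟩ := hm
  by_cases ht : v.1 ∈ touched f
  · obtain ⟨e1, e2, e3⟩ := update_of_mem_touched f hv ht c
    have e4 := numUnused_update_le f hv c
    rw [← hf'] at e1 e2 e3 e4
    have hu' : 0 < numUntouched f' := by omega
    by_cases hfree : 0 < (freeTouched f').card
    · refine Or.inr ⟨hu', fun hs => ?_⟩
      obtain ⟨g, hg, g1, g2, g3, g4⟩ := exists_gameMove_freeTouched hr hu' hfree hs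
      exact ⟨g, hg, Or.inr ⟨by omega, by omega, by omega⟩⟩
    · by_cases hbig : ∃ i, i ∉ touched f' ∧ 3 ≤ r i
      · obtain ⟨i, hi, hri⟩ := hbig
        refine Or.inr ⟨hu', fun hs => ?_⟩
        obtain ⟨g, hg, g1, g2, g3, g4⟩ := exists_gameMove_untouched hr hi hs
        exact ⟨g, hg, Or.inr ⟨by omega, by omega, by omega⟩⟩
      · push Not at hbig
        left
        have hs : halfSum f' = numUntouched f' := by
          rw [halfSum, numUntouched, Finset.card_eq_sum_ones]
          refine Finset.sum_congr rfl fun i hi => ?_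
          have := hbig i (Finset.mem_compl.1 hi)
          have := h2 i
          omega
        omega
  · obtain ⟨e1, e2, e3⟩ := update_of_notMem_touched f ht c
    have e4 := numUnused_update_of_notMem f hv (notMem_usedColors_of_legalColor ht hc)
    rw [← hf'] at e1 e2 e3 e4
    have hu' : 0 < numUntouched f' := by omega
    have hrv := h2 v.1
    refine Or.inr ⟨hu', fun hs => ?_⟩
    obtain ⟨g, hg, g1, g2, g3, g4⟩ := exists_gameMove_freeTouched hr hu' (by omega) hs
    exact ⟨g, hg, Or.inr ⟨by omega, by omega, by omega⟩⟩

theorem not_aliceWins_of_lt (h2 : ∀ j, 2 ≤ r j) (h : m + 2 < 2 * k)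
    (hsum : m < ∑ i, (r i + 1) / 2) : ¬ aliceWins (K k r) m := by
  have hr : ∀ j, 0 < r j := fun j => lt_of_lt_of_le two_pos (h2 j)
  refine not_aliceWinsFrom_of_invariant (K k r) bobInvariant bobCanMove ?_ ?_ ?_ ?_ _ _ ?_ ?_
  · rintro f (hf | ⟨-, hf, -⟩) <;> exact not_isFull_of_numUntouched_pos hr (by omega)
  · rintro f (hf | ⟨hf, -⟩) <;> exact not_isFull_of_numUntouched_pos hr (by omega)
  · exact fun f f' hf _ hm => bobCanMove_of_gameMove h2 hf hm
  · rintro f (hf | ⟨-, hf⟩) hs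
    · obtain ⟨v, hv⟩ := exists_notMem_touched hr (f := f) (by omega)
      obtain ⟨f', hm, -⟩ := exists_gameMove_untouched hr hv hs
      exact ⟨f', hm, Or.inl (numUnused_lt_of_gameMove hf hm)⟩
    · exact hf hs
  · intro _
    have hT : touched (fun _ : (Σ i : Fin k, Fin (r i)) => (none : Option (Fin m))) = ∅ := by
      simp [touched]
    have hU : usedColors (fun _ : (Σ i : Fin k, Fin (r i)) => (none : Option (Fin m))) = ∅ := by
      simp [usedColors]
    right
    simp only [numUnused, numUntouched, halfSum, hT, hU, Finset.compl_empty, Finset.card_univ,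
      Fintype.card_fin]
    omega
  · exact fun ht => absurd (by simp [aliceTurn]) ht

end Multipartite

theorem game_chromatic_ge_of_three (k : ℕ) (hk : 3 ≤ k) (r : Fin k → ℕ)
    (hanti : Antitone r) (h2 : ∀ j, 2 ≤ r j) (h3 : ∃ j, r j = 3) :
    min (2 * k - 2) (∑ i, (r i + 1) / 2) ≤ gameChromaticNumber (K k r) := by
  refine le_csInf ⟨_, aliceWins_card (K k r)⟩ fun m hm => ?_
  by_contra! hlt
  rw [lt_min_iff] at hlt
  exact not_aliceWins_of_lt h2 (by omega) hlt.2 hm
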